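/- For every integer ℓ ≥ 1, the family (1/z_k^{ℓ+1})_{k ∈ ℤ}, where z_k = log 2 + 2πki ∈ ℂ, is summable and r_ℓ = (ℓ!/2) · ∑_{k ∈ ℤ} 1/z_k^{ℓ+1}. Equivalently, in real terms, r_ℓ = ℓ!/(2·(log 2)^{ℓ+1}) + ∑_{k ≥ 1} (ℓ! / ((log 2)^2 + 4π²k²)^{(ℓ+1)/2}) · T_{ℓ+1}( log 2 / √((log 2)^2 + 4π²k²) ), where T_n is the n-th Chebyshev polynomial of the first kind (defined by cos(nθ) = T_n(cos θ)). -/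

import Mathlib

/-- `IsBPA m ℓ f` : `f` encodes a barred preferential arrangement of `[ℓ]` with `m` bars.
Each element of `[ℓ]` is assigned a section (one of the `m + 1` sections determined by the
`m` bars) together with a rank inside its section (ties are allowed: elements of the same
section with the same rank form a block); within each section the set of ranks actually used
must be an initial segment `{0, …, t-1}`, so that `f` determines, for each section, an
ordered partition of the elements assigned to it into nonempty blocks. -/
def IsBPA (m ℓ : ℕ) (f : Fin ℓ → Fin (m + 1) × Fin ℓ) : Prop :=
  ∀ x : Fin ℓ, ∀ r : Fin ℓ, r < (f x).2 → ∃ y : Fin ℓ, (f y).1 = (f x).1 ∧ (f y).2 = r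

instance (m ℓ : ℕ) : DecidablePred (IsBPA m ℓ) := fun f => by unfold IsBPA; infer_instance

/-- `bpa m ℓ` : the number of barred preferential arrangements of `[ℓ]` with `m` bars.
In particular `bpa 0 ℓ` is the number of preferential arrangements of `[ℓ]`
(the Fubini / ordered Bell number `r_ℓ`). -/
def bpa (m ℓ : ℕ) : ℕ :=
  Fintype.card { f : Fin ℓ → Fin (m + 1) × Fin ℓ // IsBPA m ℓ f }

open Finset in
/-- The number of surjections from `Fin ℓ` onto `Fin t`. -/
def surjCount (ℓ t : ℕ) : ℕ := #{f : Fin ℓ → Fin t | Function.Surjective f}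

open Finset in
lemma surjCount_eq_zero_of_lt {ℓ t : ℕ} (h : ℓ < t) : surjCount ℓ t = 0 := by
  rw [surjCount, card_eq_zero, filter_eq_empty_iff]
  intro f _ hf
  have := Fintype.card_le_of_surjective f hf
  simp only [Fintype.card_fin] at this
  omega

open Finset in
lemma card_filter_image_eq {β : Type*} [Fintype β] [DecidableEq β] (ℓ : ℕ) (S : Finset β) :
    #{f : Fin ℓ → β | univ.image f = S} = surjCount ℓ #S := by
  symm
  refine card_bij (fun g _ x => (S.equivFin.symm (g x) : β)) ?_ ?_ ?_
  · intro g hg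
    simp only [mem_filter_univ] at hg ⊢
    ext b
    simp only [mem_image, mem_univ, true_and]
    constructor
    · rintro ⟨x, rfl⟩
      exact Subtype.coe_prop _
    · intro hb
      obtain ⟨x, hx⟩ := hg (S.equivFin ⟨b, hb⟩)
      exact ⟨x, by simp [hx]⟩
  · intro g _ g' _ h
    funext x
    simpa [Subtype.ext_iff.symm] using congrFun h x
  · intro f hf
    simp only [mem_filter_univ] at hf
    have hmem (x : Fin ℓ) : f x ∈ S := hf ▸ mem_image_of_mem f (mem_univ x)
    refine ⟨fun x => S.equivFin ⟨f x, hmem x⟩, ?_, by simp⟩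
    simp only [mem_filter_univ]
    intro i
    have hi := (S.equivFin.symm i).2
    obtain ⟨x, -, hx⟩ := mem_image.mp (hf.superset hi)
    exact ⟨x, by simp [hx]⟩

open Finset in
lemma pow_eq_sum_choose_mul_surjCount (ℓ n : ℕ) :
    n ^ ℓ = ∑ t ∈ range (ℓ + 1), n.choose t * surjCount ℓ t := by
  have h₁ : n ^ ℓ = ∑ S ∈ (univ : Finset (Fin n)).powerset, surjCount ℓ #S := by
    have := card_eq_sum_card_fiberwise (s := (univ : Finset (Fin ℓ → Fin n)))
      (t := (univ : Finset (Fin n)).powerset) (f := fun f => univ.image f) (by simp [Set.MapsTo])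
    simpa [card_filter_image_eq] using this
  rw [h₁, sum_powerset_apply_card, card_univ, Fintype.card_fin]
  simp only [smul_eq_mul]
  rw [sum_subset (range_mono (show n + 1 ≤ n + ℓ + 1 by omega)),
    sum_subset (s₁ := range (ℓ + 1)) (range_mono (show ℓ + 1 ≤ n + ℓ + 1 by omega))]
  · intro t _ ht
    rw [surjCount_eq_zero_of_lt (by simpa [Nat.succ_le_iff] using ht), mul_zero]
  · intro t _ ht
    rw [Nat.choose_eq_zero_of_lt (by simpa [Nat.succ_le_iff] using ht), zero_mul]

open Finset in
/-- A map into `Fin ℓ` has downward closed image iff its image is an initial segment. -/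
lemma isLowerSet_image_iff {ℓ : ℕ} (f : Fin ℓ → Fin ℓ) :
    (∀ x r, r < f x → ∃ y, f y = r) ↔
      univ.image f = ({i | (i : ℕ) < #(univ.image f)} : Finset (Fin ℓ)) := by
  constructor
  · intro h
    have hsub : univ.image f ⊆ ({i | (i : ℕ) < #(univ.image f)} : Finset (Fin ℓ)) := by
      intro i hi
      obtain ⟨x, -, rfl⟩ := mem_image.mp hi
      have : Iic (f x) ⊆ univ.image f := by
        intro r hr
        rcases (mem_Iic.mp hr).lt_or_eq with hr | rfl
        · obtain ⟨y, hy⟩ := h x r hr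
          exact mem_image.mpr ⟨y, mem_univ y, hy⟩
        · exact hi
      have := card_le_card this
      rw [Fin.card_Iic] at this
      simpa using this
    refine eq_of_subset_of_card_le hsub ?_
    rw [Fin.card_filter_val_lt]
    exact min_le_right _ _
  · intro h x r hr
    have hx : f x ∈ univ.image f := mem_image_of_mem f (mem_univ x)
    rw [h, mem_filter_univ] at hx
    have hr' : r ∈ univ.image f := by
      rw [h, mem_filter_univ]
      exact lt_trans hr hx
    simpa using hr'

open Finset in
lemma bpa_zero_eq_sum_surjCount (ℓ : ℕ) : bpa 0 ℓ = ∑ t ∈ range (ℓ + 1), surjCount ℓ t := by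
  have h₁ : bpa 0 ℓ = #{f : Fin ℓ → Fin ℓ | ∀ x r, r < f x → ∃ y, f y = r} := by
    rw [bpa, Fintype.card_subtype]
    refine card_bij (fun f _ x => (f x).2) ?_ ?_ ?_
    · intro f hf
      simp only [mem_filter_univ] at hf ⊢
      intro x r hr
      obtain ⟨y, -, hy⟩ := hf x r hr
      exact ⟨y, hy⟩
    · intro f _ g _ h
      funext x
      exact Prod.ext (Subsingleton.elim (α := Fin 1) _ _) (congrFun h x)
    · intro f hf
      simp only [mem_filter_univ] at hf
      refine ⟨fun x => (0, f x), ?_, rfl⟩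
      simp only [mem_filter_univ]
      intro x r hr
      obtain ⟨y, hy⟩ := hf x r hr
      exact ⟨y, rfl, hy⟩
  rw [h₁, card_eq_sum_card_fiberwise (t := range (ℓ + 1)) (f := fun f => #(univ.image f))]
  · refine sum_congr rfl fun t ht => ?_
    have htℓ : t ≤ ℓ := by simpa [Nat.lt_succ_iff] using ht
    have hcard : #({i | (i : ℕ) < t} : Finset (Fin ℓ)) = t := by
      rw [Fin.card_filter_val_lt, min_eq_right htℓ]
    rw [← hcard, ← card_filter_image_eq, hcard, filter_filter]
    congr 1
    ext f
    simp only [mem_filter_univ, isLowerSet_image_iff]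
    constructor
    · rintro ⟨h, rfl⟩
      exact h
    · intro h
      have : #(univ.image f) = t := by rw [h, hcard]
      exact ⟨by rw [this, h], this⟩
  · intro f _
    have : #(univ.image f) ≤ ℓ := by simpa using card_image_le (s := univ) (f := f)
    simpa [Nat.lt_succ_iff] using this

lemma hasSum_choose_mul_half_pow (t : ℕ) :
    HasSum (fun n : ℕ => (n.choose t : ℂ) * (1 / 2) ^ n) 2 := by
  have h := (hasSum_choose_mul_geometric_of_norm_lt_one t
    (r := (1 / 2 : ℂ)) (by norm_num)).mul_right ((1 / 2) ^ t)
  rw [show 1 / (1 - 1 / 2 : ℂ) ^ (t + 1) * (1 / 2) ^ t = 2 by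
    norm_num [pow_succ]] at h
  rw [← hasSum_nat_add_iff' t]
  have h0 : ∑ i ∈ Finset.range t, (i.choose t : ℂ) * (1 / 2) ^ i = 0 :=
    Finset.sum_eq_zero fun i hi => by
      rw [Nat.choose_eq_zero_of_lt (Finset.mem_range.mp hi)]; simp
  rw [h0, sub_zero]
  exact h.congr_fun fun n => by ring

/-- Dobiński-type formula for the ordered Bell numbers. -/
lemma hasSum_pow_mul_half_pow (ℓ : ℕ) :
    HasSum (fun n : ℕ => (n : ℂ) ^ ℓ * (1 / 2) ^ n) (2 * bpa 0 ℓ) := by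
  have h := hasSum_sum (s := Finset.range (ℓ + 1)) fun t _ =>
    (hasSum_choose_mul_half_pow t).mul_right (surjCount ℓ t : ℂ)
  rw [← Finset.mul_sum] at h
  rw [bpa_zero_eq_sum_surjCount]
  push_cast
  refine h.congr_fun fun n => ?_
  have := congrArg (Nat.cast : ℕ → ℂ) (pow_eq_sum_choose_mul_surjCount ℓ n)
  push_cast at this
  rw [this, Finset.sum_mul]
  exact Finset.sum_congr rfl fun t _ => by ring

lemma one_div_log_two_add_pow_eq (k : ℤ) (n : ℕ) :
    1 / ((Real.log 2 : ℂ) + 2 * Real.pi * k * Complex.I) ^ n =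
      1 / (-2 * Real.pi * Complex.I) ^ n *
        (1 / (Complex.I * (Real.log 2 / (2 * Real.pi) : ℝ) + ((Equiv.neg ℤ k : ℤ) : ℂ)) ^ n) := by
  have hpi : (Real.pi : ℂ) ≠ 0 := by simp [Real.pi_ne_zero]
  rw [one_div_mul_one_div, ← mul_pow (-2 * Real.pi * Complex.I : ℂ)]
  congr 2
  rw [Equiv.neg_apply]
  push_cast
  field_simp
  linear_combination (Real.log 2 : ℂ) * Complex.I_sq

lemma summable_one_div_log_two_add_pow (ℓ : ℕ) (hℓ : 1 ≤ ℓ) :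
    Summable (fun k : ℤ =>
      1 / ((Real.log 2 : ℂ) + 2 * Real.pi * k * Complex.I) ^ (ℓ + 1)) := by
  have h := EisensteinSeries.linear_right_summable
    (Complex.I * (Real.log 2 / (2 * Real.pi) : ℝ)) 1 (k := (ℓ + 1 : ℕ)) (by omega)
  have h' := ((Equiv.neg ℤ).summable_iff.mpr h).mul_left
    (1 / (-2 * Real.pi * Complex.I) ^ (ℓ + 1))
  refine h'.congr fun k => ?_
  rw [one_div_log_two_add_pow_eq, one_div (_ ^ (ℓ + 1)), one_div (_ ^ (ℓ + 1))]
  simp only [Function.comp_apply, zpow_natCast, Int.cast_one, one_mul]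

lemma tsum_one_div_log_two_add_pow (ℓ : ℕ) (hℓ : 1 ≤ ℓ) :
    ∑' k : ℤ, 1 / ((Real.log 2 : ℂ) + 2 * Real.pi * k * Complex.I) ^ (ℓ + 1) =
      2 * bpa 0 ℓ / (Nat.factorial ℓ : ℂ) := by
  have hpi : (Real.pi : ℂ) ≠ 0 := by simp [Real.pi_ne_zero]
  have hpos : 0 < Real.log 2 / (2 * Real.pi) := by
    have := Real.log_pos one_lt_two
    positivity
  let z : UpperHalfPlane := ⟨Complex.I * (Real.log 2 / (2 * Real.pi) : ℝ), by
    rw [Complex.I_mul_im, Complex.ofReal_re]; exact hpos⟩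
  have hz : (z : ℂ) = Complex.I * (Real.log 2 / (2 * Real.pi) : ℝ) := rfl
  have hexp : Complex.exp (2 * Real.pi * Complex.I * z) = 1 / 2 := by
    have : 2 * Real.pi * Complex.I * z = ((-Real.log 2 : ℝ) : ℂ) := by
      rw [hz]
      push_cast
      field_simp
      linear_combination (Real.log 2 : ℂ) * Complex.I_sq
    rw [this, ← Complex.ofReal_exp, Real.exp_neg, Real.exp_log two_pos]
    norm_num
  have hq := EisensteinSeries.qExpansion_identity hℓ z
  rw [hexp, (hasSum_pow_mul_half_pow ℓ).tsum_eq, hz] at hq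
  simp_rw [one_div_log_two_add_pow_eq, tsum_mul_left]
  rw [(Equiv.neg ℤ).tsum_eq (fun k : ℤ =>
    1 / (Complex.I * (Real.log 2 / (2 * Real.pi) : ℝ) + (k : ℂ)) ^ (ℓ + 1)), hq]
  field_simp

/-- The sum of the inverse powers of two conjugate numbers, through Chebyshev polynomials. -/
lemma one_div_pow_add_one_div_pow_conj (w : ℂ) (hw : w ≠ 0) (n : ℕ) :
    1 / w ^ n + 1 / (starRingEnd ℂ w) ^ n =
      ((2 * (1 / ‖w‖ ^ n * (Polynomial.Chebyshev.T ℝ n).eval (w.re / ‖w‖)) : ℝ) : ℂ) := by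
  have hnorm : ‖w‖ ≠ 0 := norm_ne_zero_iff.mpr hw
  have hre : (w ^ n).re = ‖w‖ ^ n * Real.cos (n * w.arg) := by
    conv_lhs => rw [← Complex.norm_mul_exp_arg_mul_I w, mul_pow, ← Complex.exp_nat_mul,
      ← mul_assoc, ← Complex.ofReal_pow, Complex.re_ofReal_mul]
    rw [← Complex.ofReal_natCast, ← Complex.ofReal_mul, Complex.exp_ofReal_mul_I_re]
  rw [← Complex.cos_arg hw, Polynomial.Chebyshev.T_real_cos]
  have hcast : ((n : ℤ) : ℝ) = n := by simp
  rw [hcast, ← map_pow]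
  have hwn : w ^ n ≠ 0 := pow_ne_zero n hw
  have hwc : starRingEnd ℂ (w ^ n) ≠ 0 := (map_ne_zero _).mpr hwn
  rw [one_div_add_one_div hwn hwc, Complex.add_conj, Complex.mul_conj, Complex.normSq_eq_norm_sq,
    hre, norm_pow, ← Complex.ofReal_div]
  congr 1
  field_simp


/-- For every `ℓ ≥ 1`, the family `(1/z_k^{ℓ+1})_{k ∈ ℤ}`, where `z_k = log 2 + 2πki`,
is summable and `r_ℓ = (ℓ!/2) · ∑_{k ∈ ℤ} 1/z_k^{ℓ+1}`.  Equivalently, in real terms,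
`r_ℓ = ℓ!/(2·(log 2)^{ℓ+1})
      + ∑_{k ≥ 1} (ℓ!/((log 2)² + 4π²k²)^{(ℓ+1)/2}) · T_{ℓ+1}(log 2/√((log 2)² + 4π²k²))`,
where `T_n` is the `n`-th Chebyshev polynomial of the first kind. -/
theorem pa_eq_convergent_asymptotic_series (ℓ : ℕ) (hℓ : 1 ≤ ℓ) :
    Summable
        (fun k : ℤ =>
          1 / ((Real.log 2 : ℂ) + 2 * Real.pi * k * Complex.I) ^ (ℓ + 1)) ∧
      (bpa 0 ℓ : ℂ) =
        (Nat.factorial ℓ : ℂ) / 2 *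
          ∑' k : ℤ, 1 / ((Real.log 2 : ℂ) + 2 * Real.pi * k * Complex.I) ^ (ℓ + 1) ∧
      (bpa 0 ℓ : ℝ) =
        (Nat.factorial ℓ : ℝ) / (2 * Real.log 2 ^ (ℓ + 1)) +
          ∑' k : ℕ,
            (Nat.factorial ℓ : ℝ) /
                (Real.log 2 ^ 2 + 4 * Real.pi ^ 2 * ((k : ℝ) + 1) ^ 2) ^
                  (((ℓ : ℝ) + 1) / 2) *
              (Polynomial.Chebyshev.T ℝ (ℓ + 1)).eval
                (Real.log 2 / Real.sqrt (Real.log 2 ^ 2 + 4 * Real.pi ^ 2 * ((k : ℝ) + 1) ^ 2)) := by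
  have hS := summable_one_div_log_two_add_pow ℓ hℓ
  have hT := tsum_one_div_log_two_add_pow ℓ hℓ
  have hfac : (Nat.factorial ℓ : ℂ) ≠ 0 := by exact_mod_cast Nat.factorial_ne_zero ℓ
  have hC : (bpa 0 ℓ : ℂ) = (Nat.factorial ℓ : ℂ) / 2 *
      ∑' k : ℤ, 1 / ((Real.log 2 : ℂ) + 2 * Real.pi * k * Complex.I) ^ (ℓ + 1) := by
    rw [hT]
    field_simp
  refine ⟨hS, hC, ?_⟩
  have hL : 0 < Real.log 2 := Real.log_pos one_lt_two
  have hpair (k : ℕ) :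
      (Nat.factorial ℓ : ℂ) / 2 *
        (1 / ((Real.log 2 : ℂ) + 2 * Real.pi * ((k + 1 : ℤ) : ℂ) * Complex.I) ^ (ℓ + 1) +
        1 / ((Real.log 2 : ℂ) + 2 * Real.pi * ((-(k + 1) : ℤ) : ℂ) * Complex.I) ^ (ℓ + 1)) =
      (((Nat.factorial ℓ : ℝ) /
          (Real.log 2 ^ 2 + 4 * Real.pi ^ 2 * ((k : ℝ) + 1) ^ 2) ^ (((ℓ : ℝ) + 1) / 2) *
        (Polynomial.Chebyshev.T ℝ (ℓ + 1)).eval (Real.log 2 /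
          Real.sqrt (Real.log 2 ^ 2 + 4 * Real.pi ^ 2 * ((k : ℝ) + 1) ^ 2)) : ℝ) : ℂ) := by
    set w : ℂ := (Real.log 2 : ℂ) + 2 * Real.pi * ((k + 1 : ℤ) : ℂ) * Complex.I with hw
    have hw' : w = ⟨Real.log 2, 2 * Real.pi * (k + 1)⟩ := by
      apply Complex.ext <;> simp [hw, -Complex.ofNat_log]
    have hconj : (Real.log 2 : ℂ) + 2 * Real.pi * ((-(k + 1) : ℤ) : ℂ) * Complex.I =
        starRingEnd ℂ w := by
      rw [hw']
      apply Complex.ext <;> simp [-Complex.ofNat_log]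
      ring
    have hre : w.re = Real.log 2 := by rw [hw']
    have hnorm : ‖w‖ =
        Real.sqrt (Real.log 2 ^ 2 + 4 * Real.pi ^ 2 * ((k : ℝ) + 1) ^ 2) := by
      rw [hw', Complex.norm_def, Complex.normSq_mk]
      congr 1
      ring
    have hw0 : w ≠ 0 := fun h => hL.ne' (by rw [← hre, h, Complex.zero_re])
    rw [hconj, one_div_pow_add_one_div_pow_conj w hw0, hre, hnorm]
    have hpow : (Real.log 2 ^ 2 + 4 * Real.pi ^ 2 * ((k : ℝ) + 1) ^ 2) ^ (((ℓ : ℝ) + 1) / 2) =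
        Real.sqrt (Real.log 2 ^ 2 + 4 * Real.pi ^ 2 * ((k : ℝ) + 1) ^ 2) ^ (ℓ + 1) := by
      rw [Real.sqrt_eq_rpow, ← Real.rpow_mul_natCast (by positivity)]
      congr 1
      push_cast
      ring
    rw [hpow]
    push_cast
    ring
  have hS₁ : Summable fun k : ℕ =>
      1 / ((Real.log 2 : ℂ) + 2 * Real.pi * ((k + 1 : ℤ) : ℂ) * Complex.I) ^ (ℓ + 1) :=
    hS.comp_injective (i := fun k : ℕ => (k + 1 : ℤ)) fun a b h => by simpa using h
  have hS₂ : Summable fun k : ℕ =>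
      1 / ((Real.log 2 : ℂ) + 2 * Real.pi * ((-(k + 1) : ℤ) : ℂ) * Complex.I) ^ (ℓ + 1) :=
    hS.comp_injective (i := fun k : ℕ => (-(k + 1) : ℤ)) fun a b h => by simpa using h
  have hsplit := tsum_of_add_one_of_neg_add_one (f := fun k : ℤ =>
    1 / ((Real.log 2 : ℂ) + 2 * Real.pi * k * Complex.I) ^ (ℓ + 1)) hS₁ hS₂
  rw [add_right_comm, ← hS₁.tsum_add hS₂] at hsplit
  rw [hsplit, mul_add, ← tsum_mul_left] at hC
  simp_rw [hpair] at hC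
  rw [← Complex.ofReal_tsum] at hC
  apply Complex.ofReal_injective
  rw [Complex.ofReal_natCast, hC, add_comm, Complex.ofReal_add]
  congr 1
  push_cast
  simp only [mul_zero, zero_mul, add_zero]
  ring
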